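/- Let 1/2 < H < 1 and for 0 < s < t ≤ 1 define K_H(t,s) = c s^{1/2−H} ∫_s^t (u−s)^{H−3/2} u^{H−1/2} du, where c > 0 is a constant, and set K_H(t,s) = 0 for s ≥ t. Then there exists a choice of the constant c > 0 (depending only on H) such that for all s, t ∈ (0,1]: ∫_0^{min(s,t)} K_H(t,u) K_H(s,u) du = (1/2)( t^{2H} + s^{2H} − |t−s|^{2H} ). -/

import Mathlib

section Helpers

open MeasureTheory Set ENNReal

lemma lint_of_interval {f : ℝ → ℝ} {x y : ℝ} (hxy : x ≤ y)
    (hf : IntervalIntegrable f volume x y) (hn : ∀ u ∈ Ioc x y, 0 ≤ f u) :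
    ∫⁻ u in Ioc x y, ENNReal.ofReal (f u) = ENNReal.ofReal (∫ u in x..y, f u) := by
  rw [intervalIntegral.integral_of_le hxy, ofReal_integral_eq_lintegral_ofReal]
  · exact (intervalIntegrable_iff_integrableOn_Ioc_of_le hxy).1 hf
  · exact (ae_restrict_iff' measurableSet_Ioc).2 (Filter.Eventually.of_forall hn)

lemma beta_lint {a : ℝ} (ha : 0 < a) (ha2 : a < 1 / 2) :
    ∫⁻ x in Ioo (0:ℝ) 1, ENNReal.ofReal (x ^ (a - 1) * (1 - x) ^ (-(2 * a)))
      = ENNReal.ofReal (ProbabilityTheory.beta a (1 - 2 * a)) := by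
  have hb := ProbabilityTheory.beta_pos ha (show 0 < 1 - 2 * a by linarith)
  have h := ProbabilityTheory.lintegral_betaPDF_eq_one ha (show 0 < 1 - 2 * a by linarith)
  rw [ProbabilityTheory.lintegral_betaPDF] at h
  rw [← mul_one (ENNReal.ofReal (ProbabilityTheory.beta a (1 - 2 * a))), ← h,
    ← lintegral_const_mul' _ _ ENNReal.ofReal_ne_top]
  refine setLIntegral_congr_fun measurableSet_Ioo fun x hx => ?_
  rw [← ENNReal.ofReal_mul hb.le]
  congr 1
  rw [show 1 - 2 * a - 1 = -(2 * a) by ring]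
  generalize ProbabilityTheory.beta a (1 - 2 * a) = B at hb
  field_simp

lemma pow_identity {a y z x D : ℝ} (hz : 0 < z) (hy : 0 < y) (hd : 0 < y - z)
    (hx : 0 < x) (hx1 : 0 < 1 - x) (hD : 0 < D) :
    (y * z * (y - z) / D ^ 2) *
      ((y * z * (1 - x) / D) ^ (-(2 * a)) * (y * (y - z) / D) ^ (a - 1)
        * (z * x * (y - z) / D) ^ (a - 1) * (y ^ a * z ^ a))
      = (y - z) ^ (2 * a - 1) * (x ^ (a - 1) * (1 - x) ^ (-(2 * a))) := by
  generalize y - z = d at *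
  generalize 1 - x = w at *
  have hl : ∀ {p q : ℝ}, 0 < p → 0 < q → Real.log p = Real.log q → p = q :=
    fun hp hq h => Real.log_injOn_pos hp hq h
  apply hl (by positivity) (by positivity)
  have e1 : ∀ {p : ℝ} (q : ℝ), 0 < p → Real.log (p ^ q) = q * Real.log p :=
    fun q hp => Real.log_rpow hp q
  have e2 : ∀ {p q : ℝ}, 0 < p → 0 < q → Real.log (p * q) = Real.log p + Real.log q :=
    fun hp hq => Real.log_mul hp.ne' hq.ne'
  have e3 : ∀ {p q : ℝ}, 0 < p → 0 < q → Real.log (p / q) = Real.log p - Real.log q :=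
    fun hp hq => Real.log_div hp.ne' hq.ne'
  have e4 : Real.log (D ^ 2) = 2 * Real.log D := by simp
  repeat first
    | rw [e1 _ (by positivity)]
    | rw [e2 (by positivity) (by positivity)]
    | rw [e3 (by positivity) (by positivity)]
    | rw [e4]
  ring

lemma inner_lint {a y z : ℝ} (ha : 0 < a) (ha2 : a < 1 / 2) (hz : 0 < z) (hzy : z < y) :
    ∫⁻ u in Ioo 0 z, ENNReal.ofReal (u ^ (-(2 * a)) * (y - u) ^ (a - 1) * (z - u) ^ (a - 1)
        * (y ^ a * z ^ a))
      = ENNReal.ofReal (ProbabilityTheory.beta a (1 - 2 * a))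
        * ENNReal.ofReal ((y - z) ^ (2 * a - 1)) := by
  have hy : 0 < y := hz.trans hzy
  have hd : 0 < y - z := sub_pos.2 hzy
  set f : ℝ → ℝ := fun x => y * z * (1 - x) / (y - x * z) with hf
  have hD : ∀ x ∈ Ioo (0:ℝ) 1, 0 < y - x * z := fun x hx => by nlinarith [hx.2]
  have him : f '' Ioo 0 1 = Ioo 0 z := by
    ext u
    constructor
    · rintro ⟨x, hx, rfl⟩
      have h1 : 0 < 1 - x := by linarith [hx.2]
      have := hD x hx
      refine ⟨by positivity, ?_⟩
      simp only [hf]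
      rw [div_lt_iff₀ this]
      have : 0 < z * x * (y - z) := by have := hx.1; positivity
      nlinarith
    · rintro ⟨h0, h1⟩
      have hyu : 0 < y - u := by linarith
      have hzu : 0 < z - u := by linarith
      refine ⟨y * (z - u) / (z * (y - u)), ⟨by positivity, ?_⟩, ?_⟩
      · rw [div_lt_one (by positivity)]
        nlinarith
      · simp only [hf]
        have e : y - y * (z - u) / (z * (y - u)) * z = y * (y - z) / (y - u) := by
          field_simp; ring
        have e2 : 1 - y * (z - u) / (z * (y - u)) = u * (y - z) / (z * (y - u)) := by
          field_simp; ring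
        rw [e, e2]
        field_simp
  have hder : ∀ x ∈ Ioo (0:ℝ) 1,
      HasDerivWithinAt f (-(y * z * (y - z) / (y - x * z) ^ 2)) (Ioo 0 1) x := by
    intro x hx
    have h := hD x hx
    have h1 : HasDerivAt (fun x : ℝ => y * z * (1 - x)) (y * z * (-1)) x :=
      ((hasDerivAt_id x).const_sub 1).const_mul (y * z)
    have h2 : HasDerivAt (fun x : ℝ => y - x * z) (-(1 * z)) x :=
      ((hasDerivAt_id x).mul_const z).const_sub y
    have h3 := (h1.div h2 h.ne').hasDerivWithinAt (s := Ioo 0 1)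
    refine h3.congr_deriv ?_
    field_simp
    ring
  have hinj : InjOn f (Ioo 0 1) := by
    intro p hp q hq h
    have h1 := hD p hp
    have h2 := hD q hq
    simp only [hf] at h
    rw [div_eq_div_iff h1.ne' h2.ne'] at h
    have : y * z * (y - z) * (p - q) = 0 := by linear_combination -h
    have h5 : y * z * (y - z) ≠ 0 := by positivity
    exact sub_eq_zero.1 ((mul_eq_zero.1 this).resolve_left h5)
  rw [← him, lintegral_image_eq_lintegral_abs_deriv_mul measurableSet_Ioo hder hinj,
    ← beta_lint ha ha2, mul_comm (lintegral _ _), ← lintegral_const_mul' _ _ ENNReal.ofReal_ne_top]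
  refine setLIntegral_congr_fun measurableSet_Ioo fun x hx => ?_
  have h := hD x hx
  have hx0 := hx.1
  have hx1 : 0 < 1 - x := by linarith [hx.2]
  rw [abs_neg, abs_of_pos (by positivity), ← ENNReal.ofReal_mul (by positivity),
    ← ENNReal.ofReal_mul (by positivity), ← pow_identity hz hy hd hx0 hx1 h]
  have e1 : y - f x = y * (y - z) / (y - x * z) := by
    simp only [hf]
    rw [eq_div_iff h.ne', sub_mul, div_mul_cancel₀ _ h.ne']
    ring
  have e2 : z - f x = z * x * (y - z) / (y - x * z) := by
    simp only [hf]
    rw [eq_div_iff h.ne', sub_mul, div_mul_cancel₀ _ h.ne']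
    ring
  rw [e1, e2]

/-- the kernel -/
noncomputable def kk (a y u : ℝ) : ℝ≥0∞ :=
  if 0 < u ∧ u < y then ENNReal.ofReal (u ^ (-a) * ((y - u) ^ (a - 1) * y ^ a)) else 0

lemma kk_meas (a : ℝ) : Measurable fun p : ℝ × ℝ => kk a p.1 p.2 := by
  unfold kk
  refine Measurable.ite ?_ (by fun_prop) (by fun_prop)
  exact (measurableSet_lt measurable_const measurable_snd).inter
    (measurableSet_lt measurable_snd measurable_fst)

lemma kk_inner {a y z : ℝ} (ha : 0 < a) (ha2 : a < 1 / 2) (hy : 0 < y) (hz : 0 < z)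
    (hne : y ≠ z) :
    ∫⁻ u, kk a y u * kk a z u = ENNReal.ofReal (ProbabilityTheory.beta a (1 - 2 * a))
        * ENNReal.ofReal (|y - z| ^ (2 * a - 1)) := by
  wlog h : z < y generalizing y z
  · have := this hz hy hne.symm (lt_of_le_of_ne (not_lt.1 h) hne)
    rw [abs_sub_comm, ← this]
    simp only [mul_comm]
  rw [abs_of_pos (sub_pos.2 h), ← inner_lint ha ha2 hz h, ← lintegral_indicator measurableSet_Ioo]
  refine lintegral_congr fun u => ?_
  by_cases hu : u ∈ Ioo 0 z
  · have hu0 := hu.1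
    have hu1 : 0 < z - u := by linarith [hu.2]
    have hu2 : 0 < y - u := by linarith
    rw [indicator_of_mem hu, kk, kk, if_pos ⟨hu.1, hu.2.trans h⟩, if_pos ⟨hu.1, hu.2⟩,
      ← ENNReal.ofReal_mul (by positivity)]
    congr 1
    rw [show -(2 * a) = -a + -a by ring, Real.rpow_add hu0]
    ring
  · rw [indicator_of_notMem hu, kk.eq_def a z u, if_neg (fun h => hu ⟨h.1, h.2⟩), mul_zero]

lemma line_lint {b t z : ℝ} (hb : 0 < b) (hz : 0 ≤ z) (hzt : z ≤ t) :
    ∫⁻ y in Ioc 0 t, ENNReal.ofReal (|y - z| ^ (b - 1))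
      = ENNReal.ofReal ((z ^ b + (t - z) ^ b) / b) := by
  have h1 : ∫⁻ y in Ioc 0 z, ENNReal.ofReal (|y - z| ^ (b - 1)) = ENNReal.ofReal (z ^ b / b) := by
    rw [setLIntegral_congr_fun (g := fun y => ENNReal.ofReal ((z - y) ^ (b - 1)))
      measurableSet_Ioc]
    · rw [lint_of_interval hz]
      · rw [intervalIntegral.integral_comp_sub_left (fun x => x ^ (b - 1)),
          integral_rpow (Or.inl (by linarith))]
        simp [Real.zero_rpow hb.ne']
      · have := (intervalIntegral.intervalIntegrable_rpow' (a := z) (b := 0)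
          (show -1 < b - 1 by linarith)).comp_sub_left z
        simpa using this
      · intro u hu
        exact Real.rpow_nonneg (by linarith [hu.2]) _
    · intro y hy
      simp only
      rw [abs_sub_comm, abs_of_nonneg (by linarith [hy.2])]
  have h2 : ∫⁻ y in Ioc z t, ENNReal.ofReal (|y - z| ^ (b - 1))
      = ENNReal.ofReal ((t - z) ^ b / b) := by
    rw [setLIntegral_congr_fun (g := fun y => ENNReal.ofReal ((y - z) ^ (b - 1)))
      measurableSet_Ioc]
    · rw [lint_of_interval hzt]
      · rw [intervalIntegral.integral_comp_sub_right (fun x => x ^ (b - 1)),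
          integral_rpow (Or.inl (by linarith))]
        simp [Real.zero_rpow hb.ne']
      · have := (intervalIntegral.intervalIntegrable_rpow' (a := 0) (b := t - z)
          (show -1 < b - 1 by linarith)).comp_sub_right z
        simpa using this
      · intro u hu
        exact Real.rpow_nonneg (by linarith [hu.1]) _
    · intro y hy
      simp only
      rw [abs_of_nonneg (by linarith [hy.1])]
  rw [← Ioc_union_Ioc_eq_Ioc hz hzt, lintegral_union measurableSet_Ioc
    (Ioc_disjoint_Ioc_of_le le_rfl), h1, h2, ← ENNReal.ofReal_add, add_div]
  · exact div_nonneg (Real.rpow_nonneg hz _) hb.le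
  · exact div_nonneg (Real.rpow_nonneg (by linarith) _) hb.le

lemma square_lint {b t s : ℝ} (hb : 0 < b) (hs : 0 ≤ s) (hst : s ≤ t) :
    ∫⁻ z in Ioc 0 s, ∫⁻ y in Ioc 0 t, ENNReal.ofReal (|y - z| ^ (b - 1))
      = ENNReal.ofReal ((t ^ (b + 1) + s ^ (b + 1) - (t - s) ^ (b + 1)) / (b * (b + 1))) := by
  rw [setLIntegral_congr_fun measurableSet_Ioc
    (fun z hz => line_lint hb hz.1.le (hz.2.trans hst))]
  have i1 : IntervalIntegrable (fun x : ℝ => x ^ b) volume 0 s :=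
    intervalIntegral.intervalIntegrable_rpow' (by linarith)
  have i2 : IntervalIntegrable (fun x : ℝ => (t - x) ^ b) volume 0 s := by
    have := (intervalIntegral.intervalIntegrable_rpow' (a := t) (b := t - s)
      (show -1 < b by linarith)).comp_sub_left t
    simpa using this
  rw [lint_of_interval hs]
  · rw [intervalIntegral.integral_div, intervalIntegral.integral_add i1 i2,
      intervalIntegral.integral_comp_sub_left (fun x => x ^ b),
      integral_rpow (Or.inl (by linarith)), integral_rpow (Or.inl (by linarith)),
      Real.zero_rpow (by linarith)]
    congr 1
    field_simp
    simp
    ring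
  · exact (i1.add i2).div_const b
  · intro u hu
    have := hu.1
    have : 0 ≤ t - u := by linarith [hu.2]
    positivity

noncomputable def MM (a t u : ℝ) : ℝ≥0∞ := ∫⁻ y in Ioc 0 t, kk a y u

lemma MM_meas (a t : ℝ) : Measurable (MM a t) :=
  Measurable.lintegral_prod_left' (f := fun p : ℝ × ℝ => kk a p.1 p.2) (kk_meas a)

lemma MM_lint {a t s : ℝ} (ha : 0 < a) (ha2 : a < 1 / 2) (hs : 0 ≤ s) (hst : s ≤ t) :
    ∫⁻ u, MM a t u * MM a s u = ENNReal.ofReal (ProbabilityTheory.beta a (1 - 2 * a))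
      * ENNReal.ofReal ((t ^ (2 * a + 1) + s ^ (2 * a + 1) - (t - s) ^ (2 * a + 1))
        / (2 * a * (2 * a + 1))) := by
  have m1 : ∀ u, Measurable fun y => kk a y u := fun u =>
    (kk_meas a).comp (measurable_id.prodMk measurable_const)
  have m2 : ∀ y, Measurable fun u => kk a y u := fun y =>
    (kk_meas a).comp (measurable_const.prodMk measurable_id)
  calc ∫⁻ u, MM a t u * MM a s u
      = ∫⁻ u, ∫⁻ z in Ioc 0 s, MM a t u * kk a z u := by
        refine lintegral_congr fun u => ?_
        rw [lintegral_const_mul _ (m1 u)]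
        rfl
    _ = ∫⁻ z in Ioc 0 s, ∫⁻ u, MM a t u * kk a z u := by
        rw [lintegral_lintegral_swap]
        refine Measurable.aemeasurable ?_
        exact ((MM_meas a t).comp measurable_fst).mul ((kk_meas a).comp measurable_swap)
    _ = ∫⁻ z in Ioc 0 s, ∫⁻ y in Ioc 0 t, ∫⁻ u, kk a y u * kk a z u := by
        refine lintegral_congr fun z => ?_
        rw [← lintegral_lintegral_swap]
        · refine lintegral_congr fun u => ?_
          rw [lintegral_mul_const _ (m1 u)]
          rfl
        · refine Measurable.aemeasurable ?_
          exact ((kk_meas a).comp measurable_swap).mul ((m2 z).comp measurable_fst)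
    _ = ∫⁻ z in Ioc 0 s, ENNReal.ofReal (ProbabilityTheory.beta a (1 - 2 * a)) *
          ∫⁻ y in Ioc 0 t, ENNReal.ofReal (|y - z| ^ (2 * a - 1)) := by
        refine setLIntegral_congr_fun measurableSet_Ioc fun z hz => ?_
        rw [← lintegral_const_mul' _ _ ENNReal.ofReal_ne_top]
        refine setLIntegral_congr_fun_ae measurableSet_Ioc ?_
        have : ∀ᵐ y : ℝ, y ≠ z := by
          simp [ae_iff]
        filter_upwards [this] with y hy hy2
        exact kk_inner ha ha2 hy2.1 hz.1 hy
    _ = _ := by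
        rw [lintegral_const_mul' _ _ ENNReal.ofReal_ne_top, square_lint (by linarith) hs hst]

lemma MM_eq {a t u : ℝ} (hu : 0 < u) (hut : u < t) :
    u ^ (-a) * ∫ y in u..t, (y - u) ^ (a - 1) * y ^ a = (MM a t u).toReal := by
  rw [← intervalIntegral.integral_const_mul, intervalIntegral.integral_of_le hut.le,
    integral_eq_lintegral_of_nonneg_ae]
  · congr 1
    rw [MM, ← lintegral_indicator measurableSet_Ioc, ← lintegral_indicator measurableSet_Ioc]
    refine lintegral_congr fun y => ?_
    by_cases h : y ∈ Ioc u t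
    · rw [indicator_of_mem h, indicator_of_mem (show y ∈ Ioc 0 t from ⟨hu.trans h.1, h.2⟩), kk,
        if_pos ⟨hu, h.1⟩]
    · rw [indicator_of_notMem h]
      by_cases h2 : y ∈ Ioc 0 t
      · rw [indicator_of_mem h2, kk, if_neg]
        exact fun h3 => h ⟨h3.2, h2.2⟩
      · rw [indicator_of_notMem h2]
  · refine (ae_restrict_iff' measurableSet_Ioc).2 (Filter.Eventually.of_forall fun y hy => ?_)
    have h1 : 0 < y - u := by linarith [hy.1]
    have h2 : 0 < y := by linarith
    simp only [Pi.zero_apply]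
    positivity
  · exact Measurable.aestronglyMeasurable (by fun_prop)

lemma MM_zero {a t u : ℝ} (h : ¬ (0 < u ∧ u < t)) : MM a t u = 0 := by
  rw [MM]
  refine setLIntegral_eq_zero measurableSet_Ioc fun y hy => ?_
  simp only [Pi.zero_apply]
  rw [kk, if_neg]
  exact fun h2 => h ⟨h2.1, h2.2.trans_le hy.2⟩

lemma main_le {a c t s : ℝ} (ha : 0 < a) (ha2 : a < 1 / 2) (hs : 0 < s) (hst : s ≤ t)
    (hc : c ^ 2 = a * (2 * a + 1) / ProbabilityTheory.beta a (1 - 2 * a))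
    (K : ℝ → ℝ → ℝ)
    (hKt : ∀ u, 0 < u → K t u = c * (MM a t u).toReal)
    (hKs : ∀ u, 0 < u → K s u = c * (MM a s u).toReal) :
    ∫ u in (0:ℝ)..s, K t u * K s u
      = (1 / 2) * (t ^ (2 * a + 1) + s ^ (2 * a + 1) - (t - s) ^ (2 * a + 1)) := by
  have hb := ProbabilityTheory.beta_pos ha (show 0 < 1 - 2 * a by linarith)
  have hL := MM_lint ha ha2 hs.le hst
  have hset : ∫⁻ u in Ioc 0 s, MM a t u * MM a s u = ∫⁻ u, MM a t u * MM a s u := by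
    rw [← lintegral_indicator measurableSet_Ioc]
    refine lintegral_congr fun u => ?_
    by_cases h : u ∈ Ioc 0 s
    · rw [indicator_of_mem h]
    · rw [indicator_of_notMem h, MM_zero (t := s), mul_zero]
      exact fun h2 => h ⟨h2.1, h2.2.le⟩
  have hm : Measurable fun u => MM a t u * MM a s u := (MM_meas a t).mul (MM_meas a s)
  have hfin : ∀ᵐ u ∂(volume.restrict (Ioc 0 s)), MM a t u * MM a s u < ∞ := by
    refine ae_lt_top hm ?_
    rw [hset, hL]
    exact ENNReal.mul_ne_top ENNReal.ofReal_ne_top ENNReal.ofReal_ne_top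
  rw [intervalIntegral.integral_of_le hs.le,
    setIntegral_congr_fun (g := fun u => c ^ 2 * (MM a t u * MM a s u).toReal) measurableSet_Ioc,
    integral_const_mul, integral_toReal hm.aemeasurable hfin, hset, hL, ENNReal.toReal_mul,
    ENNReal.toReal_ofReal hb.le, ENNReal.toReal_ofReal, hc]
  · generalize ProbabilityTheory.beta a (1 - 2 * a) = B at hb
    field_simp
  · have h1 : (t - s) ^ (2 * a + 1) ≤ t ^ (2 * a + 1) :=
      Real.rpow_le_rpow (by linarith) (by linarith) (by linarith)
    have h2 : 0 ≤ s ^ (2 * a + 1) := by positivity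
    exact div_nonneg (by linarith) (by positivity)
  · intro u hu
    simp only
    rw [hKt u hu.1, hKs u hu.1, ENNReal.toReal_mul]
    ring

end Helpers

/-- There is a constant `c > 0` (depending only on `H ∈ (1/2,1)`) such that the Volterra
kernel `K_H(t,s) = c s^{1/2−H} ∫_s^t (u−s)^{H−3/2} u^{H−1/2} du` (for `0 < s < t ≤ 1`,
and `K_H(t,s) = 0` for `s ≥ t`) reproduces the fractional Brownian covariance:
`∫_0^{min(s,t)} K_H(t,u) K_H(s,u) du = (1/2)(t^{2H} + s^{2H} − |t−s|^{2H})`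
for all `s, t ∈ (0,1]`. -/
theorem stmt_3 (H : ℝ) (hH1 : 1 / 2 < H) (hH2 : H < 1) :
    ∃ c : ℝ, 0 < c ∧
      ∀ K : ℝ → ℝ → ℝ,
        (∀ t s : ℝ, 0 < s → s < t → t ≤ 1 →
          K t s = c * s ^ (1 / 2 - H) *
            ∫ u in s..t, (u - s) ^ (H - 3 / 2) * u ^ (H - 1 / 2)) →
        (∀ t s : ℝ, t ≤ s → K t s = 0) →
        ∀ s ∈ Set.Ioc (0:ℝ) 1, ∀ t ∈ Set.Ioc (0:ℝ) 1,
          ∫ u in (0:ℝ)..(min s t), K t u * K s u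
            = (1 / 2) * (t ^ (2 * H) + s ^ (2 * H) - |t - s| ^ (2 * H)) := by
  have ha : 0 < H - 1 / 2 := by linarith
  have ha2 : H - 1 / 2 < 1 / 2 := by linarith
  have hb := ProbabilityTheory.beta_pos ha (show 0 < 1 - 2 * (H - 1 / 2) by linarith)
  have hq : 0 < (H - 1 / 2) * (2 * (H - 1 / 2) + 1)
      / ProbabilityTheory.beta (H - 1 / 2) (1 - 2 * (H - 1 / 2)) := by positivity
  refine ⟨√((H - 1 / 2) * (2 * (H - 1 / 2) + 1)
      / ProbabilityTheory.beta (H - 1 / 2) (1 - 2 * (H - 1 / 2))), Real.sqrt_pos.2 hq, ?_⟩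
  have hc := Real.sq_sqrt hq.le
  generalize √((H - 1 / 2) * (2 * (H - 1 / 2) + 1)
      / ProbabilityTheory.beta (H - 1 / 2) (1 - 2 * (H - 1 / 2))) = c at hc ⊢
  intro K hK hK0
  have key : ∀ t ≤ 1, ∀ u, 0 < u → K t u = c * (MM (H - 1 / 2) t u).toReal := by
    intro t ht u hu
    by_cases hut : u < t
    · rw [hK t u hu hut ht, ← MM_eq hu hut, mul_assoc,
        show -(H - 1 / 2) = 1 / 2 - H by ring, show H - 1 / 2 - 1 = H - 3 / 2 by ring]
    · rw [hK0 t u (not_lt.1 hut), MM_zero (fun h => hut h.2)]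
      simp
  have hH : 2 * H = 2 * (H - 1 / 2) + 1 := by ring
  intro s hs t ht
  rcases le_total s t with h | h
  · rw [min_eq_left h, abs_of_nonneg (sub_nonneg.2 h), hH]
    exact main_le ha ha2 hs.1 h hc K (key t ht.2) (key s hs.2)
  · rw [min_eq_right h, abs_sub_comm, abs_of_nonneg (sub_nonneg.2 h), hH]
    have := main_le ha ha2 ht.1 h hc K (key s hs.2) (key t ht.2)
    rw [add_comm (t ^ _), ← this]
    simp only [mul_comm]
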